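/- Let ρ be a nontrivial zero of the Riemann zeta function with Re(ρ) < 1/2. Then there exists a constant C > 0 such that for every positive integer l, ∫₀^∞ |∫₀^{1/2} g_ρ(x·t)·(1/(πt) − 1/sin(πt))·sin((2l+1)πt) dt|² dx ≤ C/(2l+1)². -/

import Mathlib

open MeasureTheory Real Filter

/-- The function `η(x) = 8πx²(πx² − 3/2)e^{−πx²}`. -/
noncomputable def eta (x : ℝ) : ℝ :=
  8 * π * x ^ 2 * (π * x ^ 2 - 3 / 2) * Real.exp (-π * x ^ 2)

/-- `g ρ = Z⁻¹ F_ρ`, given by `g ρ t = ∫₁^∞ η(u·t)·u^{ρ−1} du`. -/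
noncomputable def g (ρ : ℂ) (t : ℝ) : ℂ :=
  ∫ u in Set.Ioi (1 : ℝ), (eta (u * t) : ℂ) * (u : ℂ) ^ (ρ - 1)

/-- `F_ρ x = ∫₁^∞ (Σ_{n≥1} η(n·t·x))·t^{ρ−1} dt`. -/
noncomputable def F (ρ : ℂ) (x : ℝ) : ℂ :=
  ∫ t in Set.Ioi (1 : ℝ), (∑' n : ℕ, (eta (((n : ℝ) + 1) * t * x) : ℂ)) * (t : ℂ) ^ (ρ - 1)

/-- `δ_{l,ρ}(x) = ∫₀^∞ g ρ (x·t)·sin((2l+1)πt)/(πt) dt`. -/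
noncomputable def delta (l : ℕ) (ρ : ℂ) (x : ℝ) : ℂ :=
  ∫ t in Set.Ioi (0 : ℝ),
    g ρ (x * t) * ((Real.sin ((2 * (l : ℝ) + 1) * π * t) / (π * t) : ℝ) : ℂ)

/-- The Fourier transform `𝔉f(y) = ∫_ℝ f(x)·e^{2πixy} dx`. -/
noncomputable def FT (f : ℝ → ℂ) (y : ℝ) : ℂ :=
  ∫ x : ℝ, f x * Complex.exp (((2 * π * x * y : ℝ) : ℂ) * Complex.I)

open scoped ENNReal NNReal

lemma abs_eta_le (x : ℝ) : |eta x| ≤ 88 * Real.exp (-(π / 2) * x ^ 2) := by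
  have hw : 0 ≤ π * x ^ 2 := by positivity
  set w := π * x ^ 2 with hwdef
  have heq : eta x = 8 * w * (w - 3 / 2) * (Real.exp (-(w / 2)) * Real.exp (-(w / 2))) := by
    rw [← Real.exp_add, eta, hwdef]
    ring_nf
  have hexp : Real.exp (-(π / 2) * x ^ 2) = Real.exp (-(w / 2)) := by
    congr 1
    rw [hwdef]
    ring
  have hquad := Real.quadratic_le_exp_of_nonneg (x := w / 2) (by positivity)
  have habs : |8 * w * (w - 3 / 2)| ≤ 88 * Real.exp (w / 2) := by
    rw [abs_le]
    constructor <;> nlinarith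
  have hcancel : Real.exp (w / 2) * Real.exp (-(w / 2)) = 1 := by
    rw [← Real.exp_add]
    simp
  rw [heq, hexp, abs_mul, abs_mul (Real.exp _), Real.abs_exp]
  calc |8 * w * (w - 3 / 2)| * (Real.exp (-(w / 2)) * Real.exp (-(w / 2)))
      ≤ 88 * Real.exp (w / 2) * (Real.exp (-(w / 2)) * Real.exp (-(w / 2))) := by gcongr
    _ = 88 * (Real.exp (w / 2) * Real.exp (-(w / 2))) * Real.exp (-(w / 2)) := by ring
    _ = 88 * Real.exp (-(w / 2)) := by rw [hcancel, mul_one]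

lemma abs_eta_le_rpow {s x : ℝ} (hs0 : 0 ≤ s) (hs1 : s ≤ 1) (hx : 0 < x) :
    |eta x| ≤ 88 * x ^ (-s) := by
  refine (abs_eta_le x).trans ?_
  gcongr
  rcases le_total x 1 with h | h
  · calc Real.exp (-(π / 2) * x ^ 2) ≤ 1 :=
          Real.exp_le_one_iff.2 (by nlinarith [pi_pos, sq_nonneg x])
      _ ≤ x ^ (-s) := Real.one_le_rpow_of_pos_of_le_one_of_nonpos hx h (by linarith)
  · calc Real.exp (-(π / 2) * x ^ 2) ≤ Real.exp (-x) :=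
          Real.exp_le_exp.2 (by nlinarith [pi_gt_three])
      _ ≤ x⁻¹ := by
          rw [Real.exp_neg]
          exact inv_anti₀ hx (by linarith [Real.add_one_le_exp x])
      _ = x ^ (-1 : ℝ) := (Real.rpow_neg_one x).symm
      _ ≤ x ^ (-s) := Real.rpow_le_rpow_of_exponent_le h (by linarith)

lemma continuous_eta : Continuous eta := by
  unfold eta
  fun_prop

lemma integrableOn_abs_eta_mul_rpow {s : ℝ} (hs : 0 < s) :
    IntegrableOn (fun v ↦ |eta v| * v ^ (s - 1)) (Set.Ioi 0) := by
  refine Integrable.mono' ((integrableOn_rpow_mul_exp_neg_mul_sq (b := π / 2) (by positivity)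
    (s := s - 1) (by linarith)).const_mul 88) ?_ ?_
  · exact (continuous_eta.abs.measurable.mul (measurable_id.pow_const _)).aestronglyMeasurable
  · filter_upwards [ae_restrict_mem measurableSet_Ioi] with v hv
    have hv0 : 0 ≤ v ^ (s - 1) := Real.rpow_nonneg (le_of_lt hv) _
    rw [Real.norm_of_nonneg (by positivity)]
    calc |eta v| * v ^ (s - 1) ≤ 88 * Real.exp (-(π / 2) * v ^ 2) * v ^ (s - 1) := by
          gcongr
          exact abs_eta_le v
      _ = _ := by ring

lemma norm_eta_mul_cpow (ρ : ℂ) (a : ℝ) {v : ℝ} (hv : 0 < v) :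
    ‖(eta a : ℂ) * (v : ℂ) ^ (ρ - 1)‖ = |eta a| * v ^ (ρ.re - 1) := by
  rw [norm_mul, Complex.norm_cpow_eq_rpow_re_of_pos hv, Complex.norm_real, Real.norm_eq_abs]
  simp

lemma continuousAt_eta_mul_cpow (ρ : ℂ) {v : ℝ} (hv : 0 < v) :
    ContinuousAt (fun v : ℝ ↦ (eta v : ℂ) * (v : ℂ) ^ (ρ - 1)) v :=
  (Complex.continuous_ofReal.comp continuous_eta).continuousAt.mul
    (Complex.continuousAt_ofReal_cpow_const v (ρ - 1) (Or.inr hv.ne'))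

lemma integrableOn_eta_mul_cpow {ρ : ℂ} (hρ : 0 < ρ.re) :
    IntegrableOn (fun v : ℝ ↦ (eta v : ℂ) * (v : ℂ) ^ (ρ - 1)) (Set.Ioi 0) := by
  refine Integrable.mono' (integrableOn_abs_eta_mul_rpow hρ) ?_ ?_
  · exact ContinuousOn.aestronglyMeasurable
      (fun v hv ↦ (continuousAt_eta_mul_cpow ρ hv).continuousWithinAt) measurableSet_Ioi
  · filter_upwards [ae_restrict_mem measurableSet_Ioi] with v hv
    exact (norm_eta_mul_cpow ρ v hv).le

/-- The substitution `v = u·y` in the integral defining `g`. -/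
lemma g_eq {ρ : ℂ} {y : ℝ} (hy : 0 < y) :
    g ρ y = (y : ℂ) ^ (-ρ) * ∫ v in Set.Ioi y, (eta v : ℂ) * (v : ℂ) ^ (ρ - 1) := by
  have hy' : (y : ℂ) ≠ 0 := by exact_mod_cast hy.ne'
  have h1 : ∀ u ∈ Set.Ioi (1 : ℝ), (eta (u * y) : ℂ) * (u : ℂ) ^ (ρ - 1) =
      (y : ℂ) ^ (1 - ρ) * ((eta (u * y) : ℂ) * ((u * y : ℝ) : ℂ) ^ (ρ - 1)) := by
    intro u hu
    have hu0 : (0 : ℝ) ≤ u := zero_le_one.trans (le_of_lt hu)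
    have hone : (y : ℂ) ^ (1 - ρ) * (y : ℂ) ^ (ρ - 1) = 1 := by
      rw [← Complex.cpow_add _ _ hy']
      simp
    rw [Complex.ofReal_mul, Complex.mul_cpow_ofReal_nonneg hu0 hy.le]
    linear_combination -((eta (u * y) : ℂ) * (u : ℂ) ^ (ρ - 1)) * hone
  rw [g, setIntegral_congr_fun measurableSet_Ioi h1, integral_const_mul,
    integral_comp_mul_right_Ioi (fun v : ℝ ↦ (eta v : ℂ) * (v : ℂ) ^ (ρ - 1)) 1 hy, one_mul,
    Complex.real_smul, ← mul_assoc, Complex.ofReal_inv, ← Complex.cpow_neg_one,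
    ← Complex.cpow_add _ _ hy']
  ring_nf

lemma norm_g_le {ρ : ℂ} {s y : ℝ} (hs0 : 0 < s) (hs : ρ.re ≤ s) (hy : 0 < y) :
    ‖g ρ y‖ ≤ (∫ v in Set.Ioi (0 : ℝ), |eta v| * v ^ (s - 1)) * y ^ (-s) := by
  have hint := integrableOn_abs_eta_mul_rpow hs0
  have hsub : Set.Ioi y ⊆ Set.Ioi 0 := Set.Ioi_subset_Ioi hy.le
  have hG : ‖∫ v in Set.Ioi y, (eta v : ℂ) * (v : ℂ) ^ (ρ - 1)‖ ≤
      ∫ v in Set.Ioi y, y ^ (ρ.re - s) * (|eta v| * v ^ (s - 1)) := by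
    refine norm_integral_le_of_norm_le ((hint.mono_set hsub).const_mul _) ?_
    filter_upwards [ae_restrict_mem measurableSet_Ioi] with v hv
    have hv0 : 0 < v := hy.trans hv
    rw [norm_eta_mul_cpow ρ v hv0]
    calc |eta v| * v ^ (ρ.re - 1) = |eta v| * (v ^ (ρ.re - s) * v ^ (s - 1)) := by
          rw [← Real.rpow_add hv0]
          ring_nf
      _ ≤ |eta v| * (y ^ (ρ.re - s) * v ^ (s - 1)) := by
          have hpow := Real.rpow_le_rpow_of_nonpos hy (le_of_lt hv) (sub_nonpos.2 hs)
          gcongr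
      _ = _ := by ring
  rw [integral_const_mul] at hG
  have hmono : ∫ v in Set.Ioi y, |eta v| * v ^ (s - 1) ≤
      ∫ v in Set.Ioi 0, |eta v| * v ^ (s - 1) := by
    refine setIntegral_mono_set hint ?_ hsub.eventuallyLE
    filter_upwards [ae_restrict_mem measurableSet_Ioi] with v hv
    exact mul_nonneg (abs_nonneg _) (Real.rpow_nonneg (le_of_lt hv) _)
  rw [g_eq hy, norm_mul, Complex.norm_cpow_eq_rpow_re_of_pos hy, Complex.neg_re]
  calc y ^ (-ρ.re) * ‖∫ v in Set.Ioi y, (eta v : ℂ) * (v : ℂ) ^ (ρ - 1)‖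
      ≤ y ^ (-ρ.re) * (y ^ (ρ.re - s) * ∫ v in Set.Ioi 0, |eta v| * v ^ (s - 1)) := by
        refine mul_le_mul_of_nonneg_left (hG.trans ?_) (by positivity)
        gcongr
    _ = (y ^ (-ρ.re) * y ^ (ρ.re - s)) * ∫ v in Set.Ioi 0, |eta v| * v ^ (s - 1) := by ring
    _ = _ := by
        rw [← Real.rpow_add hy, mul_comm]
        ring_nf

lemma hasDerivAt_g {ρ : ℂ} (hρ : 0 < ρ.re) {y : ℝ} (hy : 0 < y) :
    HasDerivAt (g ρ) ((-ρ * g ρ y - eta y) / y) y := by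
  have hy' : (y : ℂ) ≠ 0 := by exact_mod_cast hy.ne'
  have hρ0 : -ρ ≠ 0 := by
    intro h
    simp [neg_eq_zero.1 h] at hρ
  have hint := integrableOn_eta_mul_cpow hρ
  set E : ℝ → ℂ := fun v ↦ (eta v : ℂ) * (v : ℂ) ^ (ρ - 1) with hE
  have hprim : HasDerivAt (fun z ↦ ∫ v in (0 : ℝ)..z, E v) (E y) y := by
    refine intervalIntegral.integral_hasDerivAt_right ?_ ?_ (continuousAt_eta_mul_cpow ρ hy)
    · rw [intervalIntegrable_iff_integrableOn_Ioc_of_le hy.le]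
      exact hint.mono_set Set.Ioc_subset_Ioi_self
    · exact ⟨Set.Ioi 0, Ioi_mem_nhds hy, hint.aestronglyMeasurable⟩
  have htail : HasDerivAt (fun z ↦ ∫ v in Set.Ioi z, E v) (-E y) y := by
    refine (hprim.const_sub (∫ v in Set.Ioi 0, E v)).congr_of_eventuallyEq ?_
    filter_upwards [Ioi_mem_nhds hy] with z hz
    rw [eq_sub_iff_add_eq, add_comm]
    exact intervalIntegral.integral_interval_add_Ioi hint
      (hint.mono_set (Set.Ioi_subset_Ioi (le_of_lt hz)))
  have hprod := (hasDerivAt_ofReal_cpow_const hy.ne' hρ0).mul htail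
  refine (hprod.congr_of_eventuallyEq ?_).congr_deriv ?_
  · filter_upwards [Ioi_mem_nhds hy] with z hz
    exact g_eq hz
  · have hEy : E y = eta y * ((y : ℂ) ^ ρ / y) := by
      simp only [hE, Complex.cpow_sub _ _ hy', Complex.cpow_one]
    rw [g_eq hy, hEy, Complex.cpow_sub _ _ hy', Complex.cpow_one]
    have hone : (y : ℂ) ^ (-ρ) * (y : ℂ) ^ ρ = 1 := by
      rw [← Complex.cpow_add _ _ hy']
      simp
    field_simp
    linear_combination -(eta y : ℂ) * hone

lemma two_mul_le_sin_pi_mul {t : ℝ} (h0 : 0 ≤ t) (h1 : t ≤ 1 / 2) : 2 * t ≤ Real.sin (π * t) := by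
  have h := Real.mul_le_sin (x := π * t) (by positivity) (by nlinarith [pi_pos])
  have h2 : 2 / π * (π * t) = 2 * t := by field_simp
  linarith

lemma abs_cscKernel_le {t : ℝ} (h0 : 0 < t) (h1 : t ≤ 1 / 2) :
    |1 / (π * t) - 1 / Real.sin (π * t)| ≤ t := by
  have hS := two_mul_le_sin_pi_mul h0.le h1
  have hs : 0 < π * t := by positivity
  have hle := Real.sin_le hs.le
  have hcube := Real.sin_ge_sub_cube hs.le
  have hS0 : 0 < Real.sin (π * t) := by linarith
  have hpi : π ^ 2 ≤ 12 := by nlinarith [pi_lt_d2, pi_pos]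
  have heq : 1 / (π * t) - 1 / Real.sin (π * t) =
      -((π * t - Real.sin (π * t)) / (π * t * Real.sin (π * t))) := by
    field_simp
    ring
  rw [heq, abs_neg, abs_of_nonneg (div_nonneg (by linarith) (by positivity)),
    div_le_iff₀ (by positivity)]
  calc π * t - Real.sin (π * t) ≤ (π * t) ^ 3 / 6 := by linarith
    _ = π ^ 2 * (π * t ^ 3) / 6 := by ring
    _ ≤ 12 * (π * t ^ 3) / 6 := by gcongr
    _ = t * (π * t * (2 * t)) := by ring
    _ ≤ t * (π * t * Real.sin (π * t)) := by gcongr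

lemma hasDerivAt_cscKernel {t : ℝ} (h0 : 0 < t) (h1 : t ≤ 1 / 2) :
    HasDerivAt (fun t ↦ 1 / (π * t) - 1 / Real.sin (π * t))
      (π * (Real.cos (π * t) / Real.sin (π * t) ^ 2 - 1 / (π * t) ^ 2)) t := by
  have hS := two_mul_le_sin_pi_mul h0.le h1
  have hS0 : Real.sin (π * t) ≠ 0 := by
    intro h
    linarith
  have hlin : HasDerivAt (fun t ↦ π * t) π t := by simpa using (hasDerivAt_id t).const_mul π
  have h := (hlin.inv (by positivity)).sub (hlin.sin.inv hS0)
  simp only [one_div]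
  refine h.congr_deriv ?_
  ring

lemma abs_deriv_cscKernel_le {t : ℝ} (h0 : 0 < t) (h1 : t ≤ 1 / 2) :
    |π * (Real.cos (π * t) / Real.sin (π * t) ^ 2 - 1 / (π * t) ^ 2)| ≤ 8 := by
  have hS := two_mul_le_sin_pi_mul h0.le h1
  have hs : 0 < π * t := by positivity
  have hle := Real.sin_le hs.le
  have hcube := Real.sin_ge_sub_cube hs.le
  have hcos := Real.one_sub_sq_div_two_le_cos (x := π * t)
  have hcos1 := Real.cos_le_one (π * t)
  have hS0 : 0 < Real.sin (π * t) := by linarith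
  have hpi : π ^ 3 ≤ 64 := by
    calc π ^ 3 ≤ 4 ^ 3 := by gcongr; exact pi_le_four
      _ = 64 := by norm_num
  set s := π * t with hsdef
  set S := Real.sin s
  set c := Real.cos s
  have hnum : |s ^ 2 * c - S ^ 2| ≤ s ^ 4 / 2 := by
    rw [abs_le]
    constructor
    · nlinarith [mul_le_mul_of_nonneg_left hcos (sq_nonneg s)]
    · have h1 : s ^ 2 - S ^ 2 ≤ s ^ 3 / 6 * (2 * s) := by
        calc s ^ 2 - S ^ 2 = (s - S) * (s + S) := by ring
          _ ≤ s ^ 3 / 6 * (2 * s) := by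
            gcongr <;> linarith
      nlinarith [mul_le_mul_of_nonneg_left hcos1 (sq_nonneg s), pow_pos hs 4]
  have heq : π * (c / S ^ 2 - 1 / s ^ 2) = π * (s ^ 2 * c - S ^ 2) / (s ^ 2 * S ^ 2) := by
    field_simp
  rw [heq, abs_div, abs_mul, abs_of_pos pi_pos, abs_of_pos (by positivity : 0 < s ^ 2 * S ^ 2),
    div_le_iff₀ (by positivity)]
  calc π * |s ^ 2 * c - S ^ 2| ≤ π * (s ^ 4 / 2) := by gcongr
    _ = π ^ 3 * (t ^ 2 * s ^ 2) / 2 := by rw [hsdef]; ring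
    _ ≤ 64 * (t ^ 2 * s ^ 2) / 2 := by gcongr
    _ = 8 * (s ^ 2 * (2 * t) ^ 2) := by ring
    _ ≤ 8 * (s ^ 2 * S ^ 2) := by gcongr

/-- The derivative of `t ↦ g ρ (x·t)·(1/(πt) − 1/sin(πt))`. -/
noncomputable def gMulCscDeriv (ρ : ℂ) (x t : ℝ) : ℂ :=
  (-ρ * g ρ (x * t) - eta (x * t)) / t * ((1 / (π * t) - 1 / Real.sin (π * t) : ℝ) : ℂ) +
    g ρ (x * t) *
      ((π * (Real.cos (π * t) / Real.sin (π * t) ^ 2 - 1 / (π * t) ^ 2) : ℝ) : ℂ)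

lemma hasDerivAt_g_mul_cscKernel {ρ : ℂ} (hρ : 0 < ρ.re) {x t : ℝ} (hx : 0 < x) (h0 : 0 < t)
    (h1 : t ≤ 1 / 2) :
    HasDerivAt (fun t : ℝ ↦ g ρ (x * t) * ((1 / (π * t) - 1 / Real.sin (π * t) : ℝ) : ℂ))
      (gMulCscDeriv ρ x t) t := by
  have hx' : (x : ℂ) ≠ 0 := by exact_mod_cast hx.ne'
  have ht' : (t : ℂ) ≠ 0 := by exact_mod_cast h0.ne'
  have hlin : HasDerivAt (fun t ↦ x * t) x t := by simpa using (hasDerivAt_id t).const_mul x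
  have hg : HasDerivAt (fun t ↦ g ρ (x * t)) ((-ρ * g ρ (x * t) - eta (x * t)) / t) t := by
    refine ((hasDerivAt_g hρ (mul_pos hx h0)).scomp t hlin).congr_deriv ?_
    rw [Complex.real_smul, Complex.ofReal_mul]
    field_simp
  exact hg.mul (hasDerivAt_cscKernel h0 h1).ofReal_comp

lemma continuousOn_gMulCscDeriv {ρ : ℂ} (hρ : 0 < ρ.re) {x : ℝ} (hx : 0 < x) :
    ContinuousOn (gMulCscDeriv ρ x) (Set.Ioc 0 (1 / 2)) := by
  have hg : ContinuousOn (fun t ↦ g ρ (x * t)) (Set.Ioc 0 (1 / 2)) := fun t ht ↦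
    ((hasDerivAt_g hρ (mul_pos hx ht.1)).continuousAt.comp
      (continuous_const_mul x).continuousAt).continuousWithinAt
  have heta := continuous_eta
  have ht0 : ∀ t ∈ Set.Ioc (0 : ℝ) (1 / 2), (t : ℂ) ≠ 0 := fun t ht ↦ by
    exact_mod_cast ht.1.ne'
  have hpt : ∀ t ∈ Set.Ioc (0 : ℝ) (1 / 2), π * t ≠ 0 := fun t ht ↦
    (mul_pos pi_pos ht.1).ne'
  have hpt2 : ∀ t ∈ Set.Ioc (0 : ℝ) (1 / 2), (π * t) ^ 2 ≠ 0 := fun t ht ↦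
    pow_ne_zero 2 (hpt t ht)
  have hsin : ∀ t ∈ Set.Ioc (0 : ℝ) (1 / 2), Real.sin (π * t) ≠ 0 := fun t ht h ↦ by
    linarith [two_mul_le_sin_pi_mul ht.1.le ht.2, ht.1]
  have hsin2 : ∀ t ∈ Set.Ioc (0 : ℝ) (1 / 2), Real.sin (π * t) ^ 2 ≠ 0 := fun t ht ↦
    pow_ne_zero 2 (hsin t ht)
  have hreal : ∀ {f : ℝ → ℝ} {S : Set ℝ}, ContinuousOn f S →
      ContinuousOn (fun t ↦ (f t : ℂ)) S := fun h ↦ Complex.continuous_ofReal.comp_continuousOn h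
  unfold gMulCscDeriv
  refine ((((continuousOn_const.mul hg).sub (hreal (by fun_prop))).div
    (hreal continuousOn_id) ht0).mul (hreal ?_)).add (hg.mul (hreal ?_))
  · exact (continuousOn_const.div (by fun_prop) hpt).sub
      (continuousOn_const.div (by fun_prop) hsin)
  · exact continuousOn_const.mul ((ContinuousOn.div (by fun_prop) (by fun_prop) hsin2).sub
      (continuousOn_const.div (by fun_prop) hpt2))

lemma norm_gMulCscDeriv_le (ρ : ℂ) {s : ℝ} (hs0 : 0 < s) (hs : ρ.re ≤ s) (hs1 : s ≤ 1) :
    ∃ K, 0 ≤ K ∧ ∀ x t : ℝ, 0 < x → 0 < t → t ≤ 1 / 2 →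
      ‖gMulCscDeriv ρ x t‖ ≤ K * x ^ (-s) * t ^ (-s) := by
  set M := ∫ v in Set.Ioi (0 : ℝ), |eta v| * v ^ (s - 1)
  have hM : 0 ≤ M := setIntegral_nonneg measurableSet_Ioi fun v hv ↦
    mul_nonneg (abs_nonneg _) (Real.rpow_nonneg (le_of_lt hv) _)
  refine ⟨‖ρ‖ * M + 88 + M * 8, by positivity, fun x t hx h0 h1 ↦ ?_⟩
  have hxt : 0 < x * t := mul_pos hx h0
  have hg := norm_g_le hs0 hs hxt
  have he := abs_eta_le_rpow hs0.le hs1 hxt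
  have hk := abs_cscKernel_le h0 h1
  have hk' := abs_deriv_cscKernel_le h0 h1
  have hnum : ‖-ρ * g ρ (x * t) - eta (x * t)‖ ≤ (‖ρ‖ * M + 88) * (x * t) ^ (-s) := by
    calc ‖-ρ * g ρ (x * t) - eta (x * t)‖ ≤ ‖ρ‖ * ‖g ρ (x * t)‖ + |eta (x * t)| := by
          refine (norm_sub_le _ _).trans ?_
          rw [norm_mul, norm_neg, Complex.norm_real, Real.norm_eq_abs]
      _ ≤ ‖ρ‖ * (M * (x * t) ^ (-s)) + 88 * (x * t) ^ (-s) := by gcongr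
      _ = _ := by ring
  rw [mul_assoc, ← Real.mul_rpow hx.le h0.le]
  refine (norm_add_le _ _).trans ?_
  rw [norm_mul, norm_mul, norm_div, Complex.norm_real, Complex.norm_real, Complex.norm_real,
    Real.norm_eq_abs, Real.norm_eq_abs, Real.norm_eq_abs, abs_of_pos h0]
  calc _ ≤ (‖ρ‖ * M + 88) * (x * t) ^ (-s) / t * t + M * (x * t) ^ (-s) * 8 := by gcongr
    _ = _ := by
      field_simp

lemma continuousOn_g_mul_cscKernel {ρ : ℂ} (hρ : 0 < ρ.re) (hρ1 : ρ.re < 1) {x : ℝ}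
    (hx : 0 < x) :
    ContinuousOn (fun t : ℝ ↦ g ρ (x * t) * ((1 / (π * t) - 1 / Real.sin (π * t) : ℝ) : ℂ))
      (Set.Icc 0 (1 / 2)) := by
  intro t ht
  rcases ht.1.eq_or_lt with rfl | h0
  · set M := ∫ v in Set.Ioi (0 : ℝ), |eta v| * v ^ (ρ.re - 1)
    have hlim : Tendsto (fun t : ℝ ↦ M * x ^ (-ρ.re) * t ^ (1 - ρ.re))
        (nhdsWithin 0 (Set.Icc 0 (1 / 2))) (nhds 0) := by
      have h : ContinuousAt (fun t : ℝ ↦ M * x ^ (-ρ.re) * t ^ (1 - ρ.re)) 0 :=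
        continuousAt_const.mul (Real.continuousAt_rpow_const _ _ (Or.inr (by linarith)))
      have h2 := h.tendsto.mono_left (nhdsWithin_le_nhds (s := Set.Icc 0 (1 / 2)))
      rwa [Real.zero_rpow (by linarith), mul_zero] at h2
    rw [ContinuousWithinAt]
    simp only [mul_zero, Real.sin_zero, div_zero, sub_zero, Complex.ofReal_zero]
    refine squeeze_zero_norm' ?_ hlim
    filter_upwards [self_mem_nhdsWithin] with t ht
    rcases ht.1.eq_or_lt with rfl | h0
    · rw [Real.zero_rpow (by linarith)]
      simp
    · rw [norm_mul, Complex.norm_real, Real.norm_eq_abs]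
      calc _ ≤ M * (x * t) ^ (-ρ.re) * t := by
            have hg := norm_g_le hρ le_rfl (mul_pos hx h0)
            exact mul_le_mul hg (abs_cscKernel_le h0 ht.2) (abs_nonneg _)
              ((norm_nonneg _).trans hg)
        _ = M * x ^ (-ρ.re) * (t ^ (-ρ.re) * t ^ (1 : ℝ)) := by
            rw [Real.mul_rpow hx.le h0.le, Real.rpow_one]
            ring
        _ = _ := by
            rw [← Real.rpow_add h0]
            ring_nf
  · exact (hasDerivAt_g_mul_cscKernel hρ hx h0 ht.2).continuousAt.continuousWithinAt

lemma intervalIntegrable_gMulCscDeriv {ρ : ℂ} (hρ : 0 < ρ.re) (hρ1 : ρ.re < 1) {x : ℝ}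
    (hx : 0 < x) : IntervalIntegrable (gMulCscDeriv ρ x) volume 0 (1 / 2) := by
  obtain ⟨K, -, hK⟩ := norm_gMulCscDeriv_le ρ hρ le_rfl hρ1.le
  refine IntervalIntegrable.mono_fun' ((intervalIntegral.intervalIntegrable_rpow'
    (r := -ρ.re) (by linarith)).const_mul (K * x ^ (-ρ.re))) ?_ ?_
  · rw [Set.uIoc_of_le (by norm_num)]
    exact (continuousOn_gMulCscDeriv hρ hx).aestronglyMeasurable measurableSet_Ioc
  · rw [Set.uIoc_of_le (by norm_num)]
    filter_upwards [ae_restrict_mem measurableSet_Ioc] with t ht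
    exact hK x t hx ht.1 ht.2

/-- Integration by parts: both boundary terms vanish, the one at `1/2` because
`cos((2l+1)π/2) = 0`. -/
lemma integral_g_mul_cscKernel_mul_sin {ρ : ℂ} (hρ : 0 < ρ.re) (hρ1 : ρ.re < 1) {x : ℝ}
    (hx : 0 < x) (l : ℕ) :
    ∫ t in (0 : ℝ)..(1 / 2), g ρ (x * t) * ((1 / (π * t) - 1 / Real.sin (π * t) : ℝ) : ℂ) *
        ((Real.sin ((2 * (l : ℝ) + 1) * π * t) : ℝ) : ℂ) =
      -∫ t in (0 : ℝ)..(1 / 2), gMulCscDeriv ρ x t *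
        ((-(Real.cos ((2 * (l : ℝ) + 1) * π * t) / ((2 * l + 1) * π)) : ℝ) : ℂ) := by
  have hN : (2 * (l : ℝ) + 1) * π ≠ 0 := by positivity
  have hv : ∀ t : ℝ, HasDerivAt
      (fun t : ℝ ↦ ((-(Real.cos ((2 * (l : ℝ) + 1) * π * t) / ((2 * l + 1) * π)) : ℝ) : ℂ))
      ((Real.sin ((2 * (l : ℝ) + 1) * π * t) : ℝ) : ℂ) t := by
    intro t
    have hlin : HasDerivAt (fun t ↦ (2 * (l : ℝ) + 1) * π * t) ((2 * (l : ℝ) + 1) * π) t := by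
      simpa using (hasDerivAt_id t).const_mul ((2 * (l : ℝ) + 1) * π)
    refine ((hlin.cos.div_const ((2 * l + 1) * π)).neg.congr_deriv ?_).ofReal_comp
    field_simp
  have hcos : Real.cos ((2 * (l : ℝ) + 1) * π * (1 / 2)) = 0 :=
    Real.cos_eq_zero_iff.2 ⟨l, by push_cast; ring⟩
  rw [intervalIntegral.integral_mul_deriv_eq_deriv_mul_of_hasDerivAt
    (u' := gMulCscDeriv ρ x) ?_ (fun t _ ↦ (hv t).continuousAt.continuousWithinAt) ?_
    (fun t _ ↦ hv t) (intervalIntegrable_gMulCscDeriv hρ hρ1 hx) ?_, hcos]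
  · simp
  · rw [Set.uIcc_of_le (by norm_num)]
    exact continuousOn_g_mul_cscKernel hρ hρ1 hx
  · intro t ht
    rw [min_eq_left (by norm_num), max_eq_right (by norm_num)] at ht
    exact hasDerivAt_g_mul_cscKernel hρ hx ht.1 ht.2.le
  · exact Continuous.intervalIntegrable (by fun_prop) _ _

lemma norm_integral_g_mul_cscKernel_mul_sin_le {ρ : ℂ} (hρ : 0 < ρ.re) {s : ℝ} (hs : ρ.re ≤ s)
    (hs1 : s < 1) :
    ∃ K : ℝ, ∀ (l : ℕ) (x : ℝ), 0 < x →
      ‖∫ t in (0 : ℝ)..(1 / 2), g ρ (x * t) * ((1 / (π * t) - 1 / Real.sin (π * t) : ℝ) : ℂ) *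
        ((Real.sin ((2 * (l : ℝ) + 1) * π * t) : ℝ) : ℂ)‖ ≤ K / (2 * l + 1) * x ^ (-s) := by
  obtain ⟨K, hK0, hK⟩ := norm_gMulCscDeriv_le ρ (hρ.trans_le hs) hs hs1.le
  refine ⟨K * ∫ t in (0 : ℝ)..(1 / 2), t ^ (-s), fun l x hx ↦ ?_⟩
  rw [integral_g_mul_cscKernel_mul_sin hρ (hs.trans_lt hs1) hx, norm_neg]
  have hbound : ∀ t ∈ Set.Ioc (0 : ℝ) (1 / 2), ‖gMulCscDeriv ρ x t *
      ((-(Real.cos ((2 * (l : ℝ) + 1) * π * t) / ((2 * l + 1) * π)) : ℝ) : ℂ)‖ ≤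
        K / (2 * l + 1) * x ^ (-s) * t ^ (-s) := by
    intro t ht
    have hcos : |Real.cos ((2 * (l : ℝ) + 1) * π * t)| / ((2 * l + 1) * π) ≤
        1 / (2 * l + 1) := by
      refine div_le_div₀ zero_le_one (Real.abs_cos_le_one _) (by positivity) ?_
      exact le_mul_of_one_le_right (by positivity) (by linarith [pi_gt_three])
    have ht0 : 0 ≤ t ^ (-s) := Real.rpow_nonneg ht.1.le _
    rw [norm_mul, Complex.norm_real, norm_neg, Real.norm_eq_abs, abs_div,
      abs_of_pos (by positivity : 0 < (2 * (l : ℝ) + 1) * π)]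
    calc _ ≤ K * x ^ (-s) * t ^ (-s) * (1 / (2 * l + 1)) := by
          gcongr
          exact hK x t hx ht.1 ht.2
      _ = _ := by ring
  calc _ ≤ ∫ t in (0 : ℝ)..(1 / 2), K / (2 * l + 1) * x ^ (-s) * t ^ (-s) :=
        intervalIntegral.norm_integral_le_of_norm_le (by norm_num)
          (Eventually.of_forall hbound)
          ((intervalIntegral.intervalIntegrable_rpow' (by linarith)).const_mul _)
    _ = _ := by
        rw [intervalIntegral.integral_const_mul]
        ring

lemma setLIntegral_nnnorm_sq_le {f : ℝ → ℂ} {S : Set ℝ} (hS : MeasurableSet S)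
    (hSpos : S ⊆ Set.Ioi 0) {s K : ℝ}
    (hf : ∀ x ∈ S, ‖f x‖ ≤ K * x ^ (-s))
    (hint : IntegrableOn (fun x : ℝ ↦ x ^ (-(2 * s))) S) :
    ∫⁻ x in S, (‖f x‖₊ : ℝ≥0∞) ^ 2 ≤ ENNReal.ofReal (K ^ 2 * ∫ x in S, x ^ (-(2 * s))) := by
  rw [← integral_const_mul, ofReal_integral_eq_lintegral_ofReal (hint.const_mul _)]
  · refine setLIntegral_mono' hS fun x hx ↦ ?_
    have hx0 : 0 < x := hSpos hx
    rw [← enorm_eq_nnnorm, ← ofReal_norm, ← ENNReal.ofReal_pow (norm_nonneg _)]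
    refine ENNReal.ofReal_le_ofReal ?_
    calc ‖f x‖ ^ 2 ≤ (K * x ^ (-s)) ^ 2 := by
          gcongr
          exact hf x hx
      _ = K ^ 2 * x ^ (-(2 * s)) := by
          rw [mul_pow, ← Real.rpow_mul_natCast hx0.le]
          ring_nf
  · filter_upwards [ae_restrict_mem hS] with x hx
    have hx0 : 0 < x := hSpos hx
    positivity

theorem stmt_11 (ρ : ℂ) (hζ : riemannZeta ρ = 0) (hρ0 : 0 < ρ.re) (hρ1 : ρ.re < 1 / 2) :
    ∃ C > (0 : ℝ), ∀ l : ℕ, 0 < l →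
      (∫⁻ x in Set.Ioi (0 : ℝ),
          (‖∫ t in (0 : ℝ)..(1 / 2),
              g ρ (x * t) * ((1 / (π * t) - 1 / Real.sin (π * t) : ℝ) : ℂ) *
                ((Real.sin ((2 * (l : ℝ) + 1) * π * t) : ℝ) : ℂ)‖₊ : ℝ≥0∞) ^ 2)
        ≤ ENNReal.ofReal (C / (2 * l + 1) ^ 2) := by
  obtain ⟨A, hA⟩ := norm_integral_g_mul_cscKernel_mul_sin_le hρ0 le_rfl
    (by linarith : ρ.re < 1)
  obtain ⟨B, hB⟩ := norm_integral_g_mul_cscKernel_mul_sin_le (s := 3 / 4) hρ0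
    (by linarith) (by norm_num)
  have hintA : IntegrableOn (fun x : ℝ ↦ x ^ (-(2 * ρ.re))) (Set.Ioc 0 1) := by
    rw [← intervalIntegrable_iff_integrableOn_Ioc_of_le zero_le_one]
    exact intervalIntegral.intervalIntegrable_rpow' (by linarith)
  have hintB : IntegrableOn (fun x : ℝ ↦ x ^ (-(2 * (3 / 4) : ℝ))) (Set.Ioi 1) :=
    integrableOn_Ioi_rpow_of_lt (by norm_num) one_pos
  set a := ∫ x in Set.Ioc (0 : ℝ) 1, x ^ (-(2 * ρ.re))
  set b := ∫ x in Set.Ioi (1 : ℝ), x ^ (-(2 * (3 / 4) : ℝ))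
  have ha : 0 ≤ a := setIntegral_nonneg measurableSet_Ioc fun x hx ↦ Real.rpow_nonneg hx.1.le _
  have hb : 0 ≤ b := setIntegral_nonneg measurableSet_Ioi fun x hx ↦
    Real.rpow_nonneg (zero_le_one.trans (le_of_lt hx)) _
  refine ⟨A ^ 2 * a + B ^ 2 * b + 1, by positivity, fun l _ ↦ ?_⟩
  rw [← Set.Ioc_union_Ioi_eq_Ioi zero_le_one]
  refine (lintegral_union_le _ _ _).trans ?_
  refine (add_le_add
    (setLIntegral_nnnorm_sq_le measurableSet_Ioc Set.Ioc_subset_Ioi_self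
      (fun x hx ↦ hA l x hx.1) hintA)
    (setLIntegral_nnnorm_sq_le measurableSet_Ioi (Set.Ioi_subset_Ioi zero_le_one)
      (fun x hx ↦ hB l x (zero_lt_one.trans hx)) hintB)).trans ?_
  rw [← ENNReal.ofReal_add (by positivity) (by positivity)]
  refine ENNReal.ofReal_le_ofReal ?_
  calc (A / (2 * (l : ℝ) + 1)) ^ 2 * a + (B / (2 * (l : ℝ) + 1)) ^ 2 * b
      = (A ^ 2 * a + B ^ 2 * b) / (2 * l + 1) ^ 2 := by
        field_simp
    _ ≤ _ := by
        gcongr ?_ / _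
        linarith
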